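/- Let k ≥ 1 be an integer, let p and γ be real numbers with p ≥ 1 and 2 − (p−1)(k−2) < γ < k, and set A = (k−γ)^p · (γ−2+(p−1)(k−2))^p / p^{2p}. Then for every nonnegative compactly supported C² function ψ : ℝᵏ → ℝ one has A · ∫_{ℝᵏ} ψ(x)^p ‖x‖^{−γ} dx ≤ ∫_{ℝᵏ} |Δψ(x)|^p ‖x‖^{2p−γ} dx. -/

import Mathlib

open MeasureTheory Metric Real

/-- The Laplacian `Δψ(x) = Σᵢ ∂²ψ/∂xᵢ²(x)` of a function on Euclidean space, as the sum of
the second derivatives along the standard coordinate directions. -/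
noncomputable def euclideanLaplacian {k : ℕ} (ψ : EuclideanSpace ℝ (Fin k) → ℝ)
    (x : EuclideanSpace ℝ (Fin k)) : ℝ :=
  ∑ i : Fin k, iteratedDeriv 2 (fun t : ℝ => ψ (x + t • EuclideanSpace.single i 1)) 0

open Filter Topology

/-- Young's inequality in the form `p a^{p-1} b ≤ (p-1) a^p + b^p`. -/
lemma mul_rpow_sub_one_mul_le {p a b : ℝ} (hp : 1 ≤ p) (ha : 0 ≤ a) (hb : 0 ≤ b) :
    p * (a ^ (p - 1) * b) ≤ (p - 1) * a ^ p + b ^ p := by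
  have hp0 : 0 < p := by linarith
  have h := Real.geom_mean_le_arith_mean2_weighted (w₁ := (p - 1) / p) (w₂ := 1 / p)
    (p₁ := a ^ p) (p₂ := b ^ p) (div_nonneg (by linarith) hp0.le) (by positivity)
    (by positivity) (by positivity) (by field_simp; ring)
  rw [← Real.rpow_mul ha, ← Real.rpow_mul hb, mul_div_cancel₀ _ hp0.ne',
    mul_div_cancel₀ _ hp0.ne', Real.rpow_one] at h
  calc p * (a ^ (p - 1) * b) ≤ p * ((p - 1) / p * a ^ p + 1 / p * b ^ p) := by gcongr
    _ = (p - 1) * a ^ p + b ^ p := by field_simp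

/-- For `0 < a ≤ s ≤ b` and any real `r`, the power `s ^ r` is at most `a ^ r + b ^ r`. -/
lemma rpow_le_rpow_add_rpow {a s b : ℝ} (r : ℝ) (ha : 0 < a) (has : a ≤ s) (hsb : s ≤ b) :
    s ^ r ≤ a ^ r + b ^ r := by
  have hs : 0 < s := ha.trans_le has
  rcases le_total 0 r with hr | hr
  · linarith [Real.rpow_le_rpow hs.le hsb hr, Real.rpow_nonneg ha.le r]
  · linarith [Real.rpow_le_rpow_of_nonpos ha has hr, Real.rpow_nonneg (hs.le.trans hsb) r]

lemma iteratedDeriv_two_line {E : Type*} [NormedAddCommGroup E] [NormedSpace ℝ E]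
    {ψ : E → ℝ} (hψ : ContDiff ℝ 2 ψ) (x v : E) :
    iteratedDeriv 2 (fun t : ℝ => ψ (x + t • v)) 0
      = fderiv ℝ (fun y => fderiv ℝ ψ y v) x v := by
  have hline : ∀ t : ℝ, HasDerivAt (fun t : ℝ => x + t • v) v t := fun t => by
    simpa using ((hasDerivAt_id t).smul_const v).const_add x
  have h1 : deriv (fun t : ℝ => ψ (x + t • v)) = fun t => fderiv ℝ ψ (x + t • v) v := by
    funext t
    exact (((hψ.differentiable (by norm_num)) _).hasFDerivAt.comp_hasDerivAt t (hline t)).deriv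
  have hD : Differentiable ℝ (fun y => fderiv ℝ ψ y v) :=
    ((hψ.fderiv_right (m := 1) (by norm_num)).clm_apply contDiff_const).differentiable
      (by norm_num)
  rw [iteratedDeriv_succ, iteratedDeriv_one, h1]
  have := ((hD (x + (0 : ℝ) • v)).hasFDerivAt.comp_hasDerivAt 0 (hline 0)).deriv
  simpa [Function.comp_def] using this

/-- The integral of a directional derivative of a compactly supported function vanishes. -/
lemma integral_lineDeriv_eq_zero {E : Type*} [NormedAddCommGroup E] [NormedSpace ℝ E]
    [FiniteDimensional ℝ E] [MeasurableSpace E] [BorelSpace E] {μ : Measure E}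
    [μ.IsAddHaarMeasure] {f f' : E → ℝ} {v : E} (hf : Continuous f)
    (hf' : Integrable f' μ) (hfs : HasCompactSupport f)
    (h : ∀ x, HasLineDerivAt ℝ f (f' x) x v) : ∫ x, f' x ∂μ = 0 := by
  have := integral_bilinear_hasLineDerivAt_right_eq_neg_left_of_integrable (μ := μ)
    (f := fun _ : E => (1 : ℝ)) (f' := fun _ => 0) (g := f) (g' := f') (v := v)
    (B := ContinuousLinearMap.mul ℝ ℝ) (by simp) (by simpa using hf')
    (by simpa using hf.integrable_of_hasCompactSupport hfs)
    (fun x _ => by simpa [HasLineDerivAt] using hasDerivAt_const (0:ℝ) (1:ℝ)) (fun x _ => h x)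
  simpa using this

lemma integrableOn_norm_rpow {k : ℕ} (hk : 1 ≤ k) {r : ℝ} (hr : -(k : ℝ) < r)
    {K : Set (EuclideanSpace ℝ (Fin k))} (hK : IsCompact K) :
    IntegrableOn (fun x => ‖x‖ ^ r) K := by
  refine (locallyIntegrable_of_norm_le_rpow (C := 1) (α := -r) (by simpa using hk)
    (by simp; linarith) (ae_of_all _ fun x => ?_) ?_).integrableOn_isCompact hK
  · simp [abs_of_nonneg (Real.rpow_nonneg (norm_nonneg x) r)]
  · exact (measurable_norm.pow_const r).aestronglyMeasurable

/-- Removal of the regularization `‖x‖² + δ` of the weight. -/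
lemma tendsto_setIntegral_regularized {k : ℕ} (hk : 1 ≤ k) {γ p : ℝ} (hγ : γ < k) (hp : 0 ≤ p)
    {K : Set (EuclideanSpace ℝ (Fin k))} (hK : IsCompact K)
    {a b d : EuclideanSpace ℝ (Fin k) → ℝ} (ha : Continuous a) (hb : Continuous b)
    (hd : Continuous d) :
    Tendsto (fun δ : ℝ => ∫ x in K, (‖x‖ ^ 2 + δ) ^ (-γ / 2) *
        (a x - b x * (‖x‖ ^ 2 + δ) ^ p + d x * (δ / (‖x‖ ^ 2 + δ)))) (𝓝[>] 0)
      (𝓝 (∫ x in K, ‖x‖ ^ (-γ) * (a x - b x * ‖x‖ ^ (2 * p)))) := by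
  have hsq : ∀ (x : EuclideanSpace ℝ (Fin k)) (r : ℝ), (‖x‖ ^ 2) ^ r = ‖x‖ ^ (2 * r) :=
    fun x r => by rw [← Real.rpow_natCast, ← Real.rpow_mul (norm_nonneg x)]; norm_num
  have : Nonempty (Fin k) := ⟨⟨0, hk⟩⟩
  have hne : ∀ᵐ x ∂(volume.restrict K), x ≠ (0 : EuclideanSpace ℝ (Fin k)) :=
    ae_restrict_of_ae (Measure.ae_ne volume 0)
  have hδ1 : ∀ᶠ δ : ℝ in 𝓝[>] 0, 0 < δ ∧ δ ≤ 1 :=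
    Filter.mem_of_superset (Ioc_mem_nhdsGT zero_lt_one) fun _ h => h
  set bound : EuclideanSpace ℝ (Fin k) → ℝ := fun x =>
    (‖x‖ ^ (-γ) + (‖x‖ ^ 2 + 1) ^ (-γ / 2)) * (|a x| + |b x| * (‖x‖ ^ 2 + 1) ^ p + |d x|)
  have hpos1 : ∀ x : EuclideanSpace ℝ (Fin k), ‖x‖ ^ 2 + 1 ≠ 0 := fun x => by positivity
  have hcw : ∀ r : ℝ, Continuous fun x : EuclideanSpace ℝ (Fin k) => (‖x‖ ^ 2 + 1) ^ r :=
    fun r => Continuous.rpow_const (by fun_prop) fun x => Or.inl (hpos1 x)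
  refine tendsto_integral_filter_of_dominated_convergence bound ?_ ?_ ?_ ?_
  · filter_upwards [hδ1] with δ hδ
    have hs : ∀ x : EuclideanSpace ℝ (Fin k), ‖x‖ ^ 2 + δ ≠ 0 := fun x => by
      have := hδ.1
      positivity
    refine Continuous.aestronglyMeasurable ?_
    refine Continuous.mul (Continuous.rpow_const (by fun_prop) fun x => Or.inl (hs x)) ?_
    refine Continuous.add (ha.sub (hb.mul (Continuous.rpow_const (by fun_prop)
      fun x => Or.inl (hs x)))) (hd.mul (Continuous.div (by fun_prop) (by fun_prop) hs))
  · filter_upwards [hδ1] with δ hδ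
    filter_upwards [hne] with x hx
    obtain ⟨h0, h1⟩ := hδ
    have hx2 : 0 < ‖x‖ ^ 2 := by positivity
    have hw := rpow_le_rpow_add_rpow (-γ / 2) hx2 (s := ‖x‖ ^ 2 + δ) (b := ‖x‖ ^ 2 + 1)
      (by linarith) (by linarith)
    rw [hsq, mul_div_cancel₀ _ two_ne_zero] at hw
    have hw0 : 0 ≤ (‖x‖ ^ 2 + δ) ^ (-γ / 2) := by positivity
    have hδs : |δ / (‖x‖ ^ 2 + δ)| ≤ 1 := by
      rw [abs_of_nonneg (by positivity), div_le_one (by positivity)]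
      linarith
    have hsp : |(‖x‖ ^ 2 + δ) ^ p| ≤ (‖x‖ ^ 2 + 1) ^ p := by
      rw [abs_of_nonneg (by positivity)]
      exact Real.rpow_le_rpow (by positivity) (by linarith) hp
    rw [norm_mul, Real.norm_of_nonneg hw0, Real.norm_eq_abs]
    refine mul_le_mul hw ?_ (abs_nonneg _) (by positivity)
    refine (abs_add_le _ _).trans (add_le_add ((abs_sub _ _).trans ?_) ?_)
    · rw [abs_mul]
      gcongr
    · rw [abs_mul]
      exact mul_le_of_le_one_right (abs_nonneg _) hδs
  · refine IntegrableOn.mul_continuousOn ?_ ?_ hK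
    · exact (integrableOn_norm_rpow hk (by linarith) hK).add
        ((hcw _).continuousOn.integrableOn_compact hK)
    · exact ((ha.abs.add (hb.abs.mul (hcw p))).add hd.abs).continuousOn
  · filter_upwards [hne] with x hx
    have hx2 : ‖x‖ ^ 2 + 0 ≠ 0 := by simpa using hx
    have hcs : ContinuousAt (fun δ : ℝ => ‖x‖ ^ 2 + δ) 0 := by fun_prop
    have key : ContinuousAt (fun δ : ℝ => (‖x‖ ^ 2 + δ) ^ (-γ / 2) *
        (a x - b x * (‖x‖ ^ 2 + δ) ^ p + d x * (δ / (‖x‖ ^ 2 + δ)))) 0 :=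
      (hcs.rpow_const (Or.inl hx2)).mul ((continuousAt_const.sub
        (continuousAt_const.mul (hcs.rpow_const (Or.inl hx2)))).add
        (continuousAt_const.mul (continuousAt_id.div hcs hx2)))
    have := key.tendsto.mono_left (nhdsWithin_le_nhds (s := Set.Ioi 0))
    simp only [add_zero, zero_div, mul_zero, hsq] at this
    rwa [mul_div_cancel₀ _ two_ne_zero] at this

/-- The divergence of `φ^{p-1} s^{1-γ/2} ∇φ + c (φ^p - e) s^{-γ/2} x`, with `s = r² + δ`, bounds
the difference of the two sides of the Rellich inequality. Here `q = ‖∇φ‖²`, `t = x · ∇φ` and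
`L = Δφ`. -/
lemma rellich_pointwise {p γ κ m c B φ δ r s q t L e : ℝ} (hp : 1 ≤ p) (hB : 0 < B)
    (hm : κ - γ = p * m) (hc : 2 - γ + c * p = 2 * (p - 1) * m)
    (hcB : c * p * m = B + (p - 1) * m ^ 2) (hφ : 0 < φ) (hδ : 0 < δ)
    (hs : s = r ^ 2 + δ) (hq : 0 ≤ q) (ht : t ^ 2 ≤ r ^ 2 * q) :
    s ^ (-γ / 2) * ((B ^ p * φ ^ p - p * B ^ (p - 1) * c * (κ - γ) * e) - |L| ^ p * s ^ p
        + p * B ^ (p - 1) * c * γ * (φ ^ p - e) * (δ / s))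
      ≤ p * B ^ (p - 1) * (((p - 1) * φ ^ (p - 2) * q + φ ^ (p - 1) * L) * s ^ (1 - γ / 2)
        + φ ^ (p - 1) * t * ((2 - γ) * s ^ (-γ / 2))
        + c * (p * φ ^ (p - 1) * s ^ (-γ / 2) * t
          + (φ ^ p - e) * (-γ * s ^ (-γ / 2 - 1) * r ^ 2 + κ * s ^ (-γ / 2)))) := by
  have hs0 : 0 < s := by rw [hs]; positivity
  have e1 : s ^ (1 - γ / 2) = s ^ (-γ / 2) * s := by
    rw [← Real.rpow_add_one hs0.ne']; ring_nf
  have e2 : s ^ (-γ / 2 - 1) = s ^ (-γ / 2) / s := Real.rpow_sub_one hs0.ne' _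
  have e3 : φ ^ (p - 1) = φ ^ (p - 2) * φ := by
    rw [← Real.rpow_add_one hφ.ne']; ring_nf
  have e4 : φ ^ p = φ ^ (p - 1) * φ := by
    rw [← Real.rpow_add_one hφ.ne']; ring_nf
  have e5 : B ^ p = B ^ (p - 1) * B := by
    rw [← Real.rpow_add_one hB.ne']; ring_nf
  have young := mul_rpow_sub_one_mul_le hp (mul_pos hB hφ).le
    (mul_nonneg (abs_nonneg L) hs0.le)
  rw [Real.mul_rpow hB.le hφ.le, Real.mul_rpow hB.le hφ.le,
    Real.mul_rpow (abs_nonneg L) hs0.le] at young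
  have hΦ : 0 < φ ^ (p - 2) := by positivity
  have hS : 0 < s ^ (-γ / 2) := by positivity
  have hβ : 0 < B ^ (p - 1) := by positivity
  have hL : -(φ ^ (p - 1) * L * s) ≤ φ ^ (p - 1) * (|L| * s) := by
    have : 0 ≤ φ ^ (p - 1) * s := by positivity
    nlinarith [neg_abs_le L]
  have hsquare : 0 ≤ (p - 1) * φ ^ (p - 2) * (q * s + 2 * m * φ * t + m ^ 2 * φ ^ 2) := by
    refine mul_nonneg (mul_nonneg (by linarith) hΦ.le) ?_
    have : t ^ 2 ≤ q * s := by rw [hs]; nlinarith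
    nlinarith [sq_nonneg (t + m * φ)]
  have hr : r ^ 2 = s - δ := by rw [hs]; ring
  have hmain : (B ^ p * φ ^ p - p * B ^ (p - 1) * c * (κ - γ) * e) - |L| ^ p * s ^ p
        + p * B ^ (p - 1) * c * γ * (φ ^ p - e) * (δ / s)
      ≤ p * B ^ (p - 1) * (((p - 1) * φ ^ (p - 2) * q + φ ^ (p - 1) * L) * s
        + φ ^ (p - 1) * t * (2 - γ)
        + c * (p * φ ^ (p - 1) * t
          + (φ ^ p - e) * ((κ - γ) + γ * (δ / s)))) := by
    have h1 := mul_le_mul_of_nonneg_left hL (mul_nonneg (by linarith : 0 ≤ p) hβ.le)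
    have h2 := mul_nonneg (mul_nonneg (by linarith : 0 ≤ p) hβ.le) hsquare
    have hid : (p - 1) * φ ^ (p - 2) * q * s + φ ^ (p - 1) * t * (2 - γ)
        + c * (p * φ ^ (p - 1) * t) + c * φ ^ p * (κ - γ)
        = (p - 1) * φ ^ (p - 2) * (q * s + 2 * m * φ * t + m ^ 2 * φ ^ 2) + B * φ ^ p := by
      rw [e4, e3, hm]
      linear_combination (φ ^ (p - 2) * φ * t) * hc + (φ ^ (p - 2) * φ * φ) * hcB
    have h3 := congrArg (fun z => p * B ^ (p - 1) * z) hid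
    rw [e5] at young ⊢
    linarith [h1, h2, h3, young]
  rw [e1, e2, hr]
  calc _ ≤ _ := mul_le_mul_of_nonneg_left hmain hS.le
    _ = _ := by field_simp; ring

lemma hasLineDerivAt_rellich_field {k : ℕ} {ψ : EuclideanSpace ℝ (Fin k) → ℝ}
    (hψ : ContDiff ℝ 2 ψ) (hpos : ∀ x, 0 ≤ ψ x) {ε δ : ℝ} (hε : 0 < ε) (hδ : 0 < δ)
    (p γ c e : ℝ) (i : Fin k) (x : EuclideanSpace ℝ (Fin k)) :
    HasLineDerivAt ℝ (fun y : EuclideanSpace ℝ (Fin k) =>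
        (ψ y + ε) ^ (p - 1) * fderiv ℝ ψ y (EuclideanSpace.single i 1)
            * (‖y‖ ^ 2 + δ) ^ (1 - γ / 2)
          + c * (((ψ y + ε) ^ p - e) * ((‖y‖ ^ 2 + δ) ^ (-γ / 2) * y i)))
      (((p - 1) * (ψ x + ε) ^ (p - 2) * fderiv ℝ ψ x (EuclideanSpace.single i 1) ^ 2
          + (ψ x + ε) ^ (p - 1) * fderiv ℝ (fun y => fderiv ℝ ψ y (EuclideanSpace.single i 1)) x
            (EuclideanSpace.single i 1)) * (‖x‖ ^ 2 + δ) ^ (1 - γ / 2)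
        + (ψ x + ε) ^ (p - 1) * (x i * fderiv ℝ ψ x (EuclideanSpace.single i 1))
          * ((2 - γ) * (‖x‖ ^ 2 + δ) ^ (-γ / 2))
        + c * (p * (ψ x + ε) ^ (p - 1) * (‖x‖ ^ 2 + δ) ^ (-γ / 2)
            * (x i * fderiv ℝ ψ x (EuclideanSpace.single i 1))
          + ((ψ x + ε) ^ p - e) * (-γ * (‖x‖ ^ 2 + δ) ^ (-γ / 2 - 1) * x i ^ 2
            + (‖x‖ ^ 2 + δ) ^ (-γ / 2)))) x (EuclideanSpace.single i 1) := by
  set v : EuclideanSpace ℝ (Fin k) := EuclideanSpace.single i 1 with hv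
  have hD : Differentiable ℝ (fun y => fderiv ℝ ψ y v) :=
    ((hψ.fderiv_right (m := 1) (by norm_num)).clm_apply contDiff_const).differentiable
      (by norm_num)
  have h1 : HasDerivAt (fun t : ℝ => ψ (x + t • v) + ε) (fderiv ℝ ψ x v) 0 :=
    ((hψ.differentiable (by norm_num) x).hasFDerivAt.hasLineDerivAt v).add_const ε
  have h2 : HasDerivAt (fun t : ℝ => fderiv ℝ ψ (x + t • v) v)
      (fderiv ℝ (fun y => fderiv ℝ ψ y v) x v) 0 := (hD x).hasFDerivAt.hasLineDerivAt v
  have h3 : HasDerivAt (fun t : ℝ => ‖x + t • v‖ ^ 2 + δ) (2 * x i) 0 := by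
    have := ((hasStrictFDerivAt_norm_sq x).hasFDerivAt.hasLineDerivAt v).add_const δ
    simpa [HasLineDerivAt, hv, EuclideanSpace.inner_single_right] using this
  have h4 : HasDerivAt (fun t : ℝ => (x + t • v) i) 1 0 := by
    simpa [hv] using (hasDerivAt_id (0 : ℝ)).const_add (x i)
  have hφ : ψ (x + (0 : ℝ) • v) + ε ≠ 0 := by linarith [hpos (x + (0 : ℝ) • v)]
  have hs : ‖x + (0 : ℝ) • v‖ ^ 2 + δ ≠ 0 := by positivity
  have := (((h1.rpow_const (p := p - 1) (Or.inl hφ)).mul h2).mul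
    (h3.rpow_const (p := 1 - γ / 2) (Or.inl hs))).add
    ((((h1.rpow_const (p := p) (Or.inl hφ)).sub_const e).mul
      ((h3.rpow_const (p := -γ / 2) (Or.inl hs)).mul h4)).const_mul c)
  refine HasDerivAt.congr_deriv this ?_
  simp only [Pi.mul_apply, zero_smul, add_zero]
  rw [show p - 1 - 1 = p - 2 by ring, show 1 - γ / 2 - 1 = -γ / 2 by ring]
  ring

lemma continuous_euclideanLaplacian {k : ℕ} {ψ : EuclideanSpace ℝ (Fin k) → ℝ}
    (hψ : ContDiff ℝ 2 ψ) : Continuous (euclideanLaplacian ψ) := by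
  unfold euclideanLaplacian
  refine continuous_finsetSum _ fun i _ => ?_
  simp only [iteratedDeriv_two_line hψ]
  exact (((hψ.fderiv_right (m := 1) (by norm_num)).clm_apply
    contDiff_const).continuous_fderiv (by norm_num)).clm_apply continuous_const

lemma euclideanLaplacian_of_notMem_tsupport {k : ℕ} {ψ : EuclideanSpace ℝ (Fin k) → ℝ}
    (hψ : ContDiff ℝ 2 ψ) {x : EuclideanSpace ℝ (Fin k)} (hx : x ∉ tsupport ψ) :
    euclideanLaplacian ψ x = 0 := by
  refine Finset.sum_eq_zero fun i _ => ?_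
  rw [iteratedDeriv_two_line hψ, fderiv_of_notMem_tsupport ℝ
    fun h => hx (tsupport_fderiv_apply_subset ℝ _ h)]
  simp

/-- The Rellich inequality with the regularized weight `(‖x‖² + δ)^{-γ/2}` and the shifted
function `ψ + ε`. -/
lemma setIntegral_rellich_regularized_le {k : ℕ} {p γ m c B : ℝ} (hp : 1 ≤ p) (hB : 0 < B)
    (hm : (k : ℝ) - γ = p * m) (hc : 2 - γ + c * p = 2 * (p - 1) * m)
    (hcB : c * p * m = B + (p - 1) * m ^ 2)
    {ψ : EuclideanSpace ℝ (Fin k) → ℝ} (hψ : ContDiff ℝ 2 ψ)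
    (hsupp : HasCompactSupport ψ) (hpos : ∀ x, 0 ≤ ψ x) {ε δ : ℝ} (hε : 0 < ε) (hδ : 0 < δ) :
    ∫ x in tsupport ψ, (‖x‖ ^ 2 + δ) ^ (-γ / 2) *
      ((B ^ p * (ψ x + ε) ^ p - p * B ^ (p - 1) * c * (k - γ) * ε ^ p)
        - |euclideanLaplacian ψ x| ^ p * (‖x‖ ^ 2 + δ) ^ p
        + p * B ^ (p - 1) * c * γ * ((ψ x + ε) ^ p - ε ^ p) * (δ / (‖x‖ ^ 2 + δ))) ≤ 0 := by
  set D : Fin k → EuclideanSpace ℝ (Fin k) → ℝ :=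
    fun i y => fderiv ℝ ψ y (EuclideanSpace.single i 1) with hDdef
  set H : Fin k → EuclideanSpace ℝ (Fin k) → ℝ :=
    fun i y => fderiv ℝ (D i) y (EuclideanSpace.single i 1) with hHdef
  have hDc1 : ∀ i, ContDiff ℝ 1 (D i) := fun i =>
    (hψ.fderiv_right (m := 1) (by norm_num)).clm_apply contDiff_const
  have hDcont : ∀ i, Continuous (D i) := fun i => (hDc1 i).continuous
  have hHcont : ∀ i, Continuous (H i) := fun i =>
    ((hDc1 i).continuous_fderiv (by norm_num)).clm_apply continuous_const
  have hψcont : Continuous ψ := hψ.continuous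
  have hψ0 : ∀ x ∉ tsupport ψ, ψ x = 0 := fun x hx => image_eq_zero_of_notMem_tsupport hx
  have hD0 : ∀ i, ∀ x ∉ tsupport ψ, D i x = 0 := fun i x hx => by
    simp [hDdef, fderiv_of_notMem_tsupport ℝ hx]
  have hH0 : ∀ i, ∀ x ∉ tsupport ψ, H i x = 0 := fun i x hx => by
    have hx' : x ∉ tsupport (D i) := fun h => hx (tsupport_fderiv_apply_subset ℝ _ h)
    simp [hHdef, fderiv_of_notMem_tsupport ℝ hx']
  have hφ : ∀ x, 0 < ψ x + ε := fun x => by linarith [hpos x]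
  have hs : ∀ x : EuclideanSpace ℝ (Fin k), 0 < ‖x‖ ^ 2 + δ := fun x => by positivity
  have hφc : ∀ r : ℝ, Continuous fun x => (ψ x + ε) ^ r := fun r =>
    Continuous.rpow_const (by fun_prop) fun x => Or.inl (hφ x).ne'
  have hsc : ∀ r : ℝ, Continuous fun x : EuclideanSpace ℝ (Fin k) => (‖x‖ ^ 2 + δ) ^ r :=
    fun r => Continuous.rpow_const (by fun_prop) fun x => Or.inl (hs x).ne'
  set W : Fin k → EuclideanSpace ℝ (Fin k) → ℝ := fun i x =>
    ((p - 1) * (ψ x + ε) ^ (p - 2) * D i x ^ 2 + (ψ x + ε) ^ (p - 1) * H i x)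
        * (‖x‖ ^ 2 + δ) ^ (1 - γ / 2)
      + (ψ x + ε) ^ (p - 1) * (x i * D i x) * ((2 - γ) * (‖x‖ ^ 2 + δ) ^ (-γ / 2))
      + c * (p * (ψ x + ε) ^ (p - 1) * (‖x‖ ^ 2 + δ) ^ (-γ / 2) * (x i * D i x)
        + ((ψ x + ε) ^ p - ε ^ p) * (-γ * (‖x‖ ^ 2 + δ) ^ (-γ / 2 - 1) * x i ^ 2
          + (‖x‖ ^ 2 + δ) ^ (-γ / 2))) with hWdef
  have hWcont : ∀ i, Continuous (W i) := fun i => by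
    have := hDcont i
    have := hHcont i
    have := hφc (p - 2)
    have := hφc (p - 1)
    have := hφc p
    have := hsc (1 - γ / 2)
    have := hsc (-γ / 2)
    have := hsc (-γ / 2 - 1)
    simp only [hWdef]
    fun_prop
  have hW0 : ∀ i, ∀ x ∉ tsupport ψ, W i x = 0 := fun i x hx => by
    simp [hWdef, hψ0 x hx, hD0 i x hx, hH0 i x hx]
  have hWint : ∀ i, Integrable (W i) := fun i =>
    (hWcont i).integrable_of_hasCompactSupport (HasCompactSupport.intro hsupp (hW0 i))
  have hWzero : ∀ i, ∫ x, W i x = 0 := fun i => by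
    refine integral_lineDeriv_eq_zero ?_ (hWint i) ?_
      (hasLineDerivAt_rellich_field hψ hpos hε hδ p γ c (ε ^ p) i)
    · have := hDcont i
      have := hφc (p - 1)
      have := hφc p
      have := hsc (1 - γ / 2)
      have := hsc (-γ / 2)
      simp only [hDdef] at *
      fun_prop
    · refine HasCompactSupport.intro hsupp fun x hx => ?_
      have := hD0 i x hx
      simp only [hDdef] at this
      simp [hψ0 x hx, this]
  have hsum : ∫ x in tsupport ψ, p * B ^ (p - 1) * ∑ i, W i x = 0 := by
    rw [setIntegral_eq_integral_of_forall_compl_eq_zero fun x hx => by simp [hW0 _ x hx],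
      integral_const_mul, integral_finsetSum _ fun i _ => hWint i]
    simp [hWzero]
  rw [← hsum]
  have hKc : IsCompact (tsupport ψ) := hsupp
  refine setIntegral_mono ?_ ?_ fun x => ?_
  · have h1 := hφc p
    have h2 := hsc p
    have h3 := hsc (-γ / 2)
    have h4 : Continuous fun x => |euclideanLaplacian ψ x| ^ p :=
      (continuous_euclideanLaplacian hψ).abs.rpow_const fun x => Or.inr (by linarith)
    have h5 : Continuous fun x : EuclideanSpace ℝ (Fin k) => δ / (‖x‖ ^ 2 + δ) :=
      Continuous.div (by fun_prop) (by fun_prop) fun x => (hs x).ne'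
    refine ContinuousOn.integrableOn_compact hKc (Continuous.continuousOn ?_)
    fun_prop
  · exact ((continuous_const.mul (continuous_finsetSum _ fun i _ => hWcont i)).continuousOn
      |>.integrableOn_compact hKc)
  · have hL : euclideanLaplacian ψ x = ∑ i, H i x :=
      Finset.sum_congr rfl fun i _ => iteratedDeriv_two_line hψ x _
    have hnorm : ‖x‖ ^ 2 = ∑ i, x i ^ 2 := EuclideanSpace.real_norm_sq_eq x
    have hpt := rellich_pointwise (κ := k) (L := euclideanLaplacian ψ x) (e := ε ^ p)
      (q := ∑ i, D i x ^ 2) (t := ∑ i, x i * D i x) (r := ‖x‖) hp hB hm hc hcB (hφ x) hδ rfl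
      (Finset.sum_nonneg fun i _ => sq_nonneg _)
      (by rw [hnorm]; exact Finset.sum_mul_sq_le_sq_mul_sq _ _ _)
    refine hpt.trans_eq ?_
    congr 1
    simp only [hWdef, Finset.sum_add_distrib, ← Finset.mul_sum, ← Finset.sum_mul, hL]
    rw [← hnorm]
    simp

/-- Flat case of the Rellich inequality for submanifolds (Theorem `rellich` of the paper
with `M = ℝᵏ`, so the radial curvature vanishes, the relaxed range
`2 − (p−1)(k−2) < γ < k` applies, `Φ = 0` and there is no boundary term). -/
theorem rellich_flat (k : ℕ) (hk : 1 ≤ k) (p γ : ℝ) (hp : 1 ≤ p)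
    (hγ₁ : 2 - (p - 1) * ((k : ℝ) - 2) < γ) (hγ₂ : γ < (k : ℝ))
    (A : ℝ) (hA : A = ((k : ℝ) - γ) ^ p * (γ - 2 + (p - 1) * ((k : ℝ) - 2)) ^ p / p ^ (2 * p))
    (ψ : EuclideanSpace ℝ (Fin k) → ℝ) (hψ : ContDiff ℝ 2 ψ)
    (hsupp : HasCompactSupport ψ) (hpos : ∀ x, 0 ≤ ψ x) :
    A * ∫ x : EuclideanSpace ℝ (Fin k), ψ x ^ p * ‖x‖ ^ (-γ)
      ≤ ∫ x : EuclideanSpace ℝ (Fin k), |euclideanLaplacian ψ x| ^ p * ‖x‖ ^ (2 * p - γ) := by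

  have hp0 : 0 < p := by linarith
  set N : ℝ := γ - 2 + (p - 1) * ((k : ℝ) - 2) with hN
  have hN0 : 0 < N := by rw [hN]; linarith
  set m : ℝ := (k - γ) / p with hm
  have hm0 : 0 < m := div_pos (by linarith) hp0
  set B : ℝ := m * N / p with hBdef
  have hB : 0 < B := by positivity
  set c : ℝ := (γ - 2 + 2 * (p - 1) * m) / p with hcdef
  have hkm : (k : ℝ) - γ = p * m := by rw [hm]; field_simp
  have hc : 2 - γ + c * p = 2 * (p - 1) * m := by rw [hcdef]; field_simp; ring
  have hcB : c * p * m = B + (p - 1) * m ^ 2 := by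
    have hk' : (k : ℝ) = γ + p * m := by linarith
    rw [hBdef, hcdef, hN, hk']
    field_simp
    ring
  have hAB : A = B ^ p := by
    rw [hA, hBdef, hm, Real.rpow_mul hp0.le, ← Real.mul_rpow (by linarith) hN0.le,
      ← Real.div_rpow (mul_nonneg (by linarith) hN0.le) (by positivity)]
    congr 1
    rw [Real.rpow_two]
    field_simp
  have hKc : IsCompact (tsupport ψ) := hsupp
  have : Nonempty (Fin k) := ⟨⟨0, hk⟩⟩
  have hΔc : Continuous fun x => |euclideanLaplacian ψ x| ^ p :=
    (continuous_euclideanLaplacian hψ).abs.rpow_const fun x => Or.inr hp0.le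
  have hψc : Continuous fun x => ψ x ^ p := hψ.continuous.rpow_const fun x => Or.inr hp0.le
  have hw := integrableOn_norm_rpow hk (r := -γ) (by linarith) hKc
  have hw' := integrableOn_norm_rpow hk (r := 2 * p - γ) (by linarith) hKc
  have hIψ : IntegrableOn (fun x => ψ x ^ p * ‖x‖ ^ (-γ)) (tsupport ψ) :=
    hw.continuousOn_mul hψc.continuousOn hKc
  have hIΔ : IntegrableOn (fun x => |euclideanLaplacian ψ x| ^ p * ‖x‖ ^ (2 * p - γ))
      (tsupport ψ) := hw'.continuousOn_mul hΔc.continuousOn hKc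
  rw [← setIntegral_eq_integral_of_forall_compl_eq_zero (s := tsupport ψ)
      (f := fun x => ψ x ^ p * ‖x‖ ^ (-γ)) fun x hx => by
        simp [image_eq_zero_of_notMem_tsupport hx, hp0.ne'],
    ← setIntegral_eq_integral_of_forall_compl_eq_zero (s := tsupport ψ)
      (f := fun x => |euclideanLaplacian ψ x| ^ p * ‖x‖ ^ (2 * p - γ)) fun x hx => by
        simp [euclideanLaplacian_of_notMem_tsupport hψ hx, hp0.ne']]
  set C : ℝ := p * B ^ (p - 1) * c * (k - γ) with hC
  have key : ∀ ε : ℝ, 0 < ε → A * ∫ x in tsupport ψ, ψ x ^ p * ‖x‖ ^ (-γ)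
      ≤ (∫ x in tsupport ψ, |euclideanLaplacian ψ x| ^ p * ‖x‖ ^ (2 * p - γ))
        + C * ε ^ p * ∫ x in tsupport ψ, ‖x‖ ^ (-γ) := by
    intro ε hε
    have hφc : Continuous fun x => (ψ x + ε) ^ p :=
      (hψ.continuous.add continuous_const).rpow_const fun x => Or.inr hp0.le
    have hlim := tendsto_setIntegral_regularized hk hγ₂ hp0.le hKc
      (a := fun x => B ^ p * (ψ x + ε) ^ p - C * ε ^ p)
      (b := fun x => |euclideanLaplacian ψ x| ^ p)
      (d := fun x => p * B ^ (p - 1) * c * γ * ((ψ x + ε) ^ p - ε ^ p))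
      (by fun_prop) hΔc (by fun_prop)
    have hle := le_of_tendsto hlim (b := 0) <| by
      filter_upwards [self_mem_nhdsWithin] with δ hδ
      exact setIntegral_rellich_regularized_le hp hB hkm hc hcB hψ hsupp hpos hε hδ
    have hnormc : Continuous fun x : EuclideanSpace ℝ (Fin k) => ‖x‖ ^ (2 * p) :=
      continuous_norm.rpow_const fun x => Or.inr (by positivity)
    have hdiff : IntegrableOn (fun x => A * (ψ x ^ p * ‖x‖ ^ (-γ))
        - |euclideanLaplacian ψ x| ^ p * ‖x‖ ^ (2 * p - γ)) (tsupport ψ) :=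
      (hIψ.const_mul A).sub hIΔ
    have hmono : ∫ x in tsupport ψ, (A * (ψ x ^ p * ‖x‖ ^ (-γ))
        - |euclideanLaplacian ψ x| ^ p * ‖x‖ ^ (2 * p - γ) - C * ε ^ p * ‖x‖ ^ (-γ)) ≤ 0 := by
      refine le_trans (setIntegral_mono_ae ?_ ?_ ?_) hle
      · exact hdiff.sub (hw.const_mul _)
      · exact hw.mul_continuousOn (by fun_prop) hKc
      · filter_upwards [Measure.ae_ne volume 0] with x hx
        have hx0 : 0 < ‖x‖ := norm_pos_iff.mpr hx
        have h1 : ‖x‖ ^ (2 * p - γ) = ‖x‖ ^ (-γ) * ‖x‖ ^ (2 * p) := by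
          rw [← Real.rpow_add hx0]; ring_nf
        have h2 : ψ x ^ p ≤ (ψ x + ε) ^ p :=
          Real.rpow_le_rpow (hpos x) (by linarith) hp0.le
        have h3 : 0 ≤ B ^ p * ‖x‖ ^ (-γ) := by positivity
        rw [h1, hAB]
        linarith [mul_le_mul_of_nonneg_left h2 h3]
    rw [integral_sub hdiff (hw.const_mul _),
      integral_sub (hIψ.const_mul A) hIΔ, integral_const_mul, integral_const_mul] at hmono
    linarith
  have hlim0 : Tendsto (fun ε : ℝ =>
      (∫ x in tsupport ψ, |euclideanLaplacian ψ x| ^ p * ‖x‖ ^ (2 * p - γ))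
        + C * ε ^ p * ∫ x in tsupport ψ, ‖x‖ ^ (-γ)) (𝓝[>] 0)
      (𝓝 (∫ x in tsupport ψ, |euclideanLaplacian ψ x| ^ p * ‖x‖ ^ (2 * p - γ))) := by
    have hcts : ContinuousAt (fun ε : ℝ =>
        (∫ x in tsupport ψ, |euclideanLaplacian ψ x| ^ p * ‖x‖ ^ (2 * p - γ))
          + C * ε ^ p * ∫ x in tsupport ψ, ‖x‖ ^ (-γ)) 0 :=
      continuousAt_const.add ((continuousAt_const.mul
        (continuousAt_id.rpow_const (Or.inr hp0.le))).mul continuousAt_const)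
    simpa [Real.zero_rpow hp0.ne'] using hcts.tendsto.mono_left nhdsWithin_le_nhds
  exact ge_of_tendsto hlim0 (by filter_upwards [self_mem_nhdsWithin] with ε hε using key ε hε)
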